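/- (Structure of smoothly reflectionless measures) Let μ be a nonzero smoothly reflectionless measure on ℝ^d. Then there exist a linear subspace V of dimension k ∈ {0,…,d}, a uniformly discrete set E ⊂ V^⊥ that is symmetric about each of its points (x, y ∈ E implies 2y − x ∈ E), and a nonnegative function f on E with f(2y−x) = f(x) for all x, y ∈ E, such that μ = Σ_{x ∈ E} f(x) · ℋ^k|(V + x). -/

import Mathlib

open MeasureTheory Metric Set Filter
noncomputable section

abbrev Pt (d : ℕ) := EuclideanSpace ℝ (Fin d)

/-- The closed support of a measure: points all of whose balls have positive measure. -/
def msupp {d : ℕ} (μ : Measure (Pt d)) : Set (Pt d) :=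
  {x | ∀ r : ℝ, 0 < r → 0 < μ (ball x r)}

/-- `μ` is smoothly reflectionless: for every odd compactly supported Lipschitz function `φ`,
the convolution `φ * μ` is constant on the support of `μ`. -/
def SmoothlyReflectionless {d : ℕ} (μ : Measure (Pt d)) : Prop :=
  ∀ φ : Pt d → ℝ, (∀ x, φ (-x) = -φ x) → HasCompactSupport φ →
    (∃ K : NNReal, LipschitzWith K φ) →
    ∃ Λ : ℝ, ∀ x ∈ msupp μ, (∫ y, φ (x - y) ∂μ) = Λ

lemma msupp_eq_support {d : ℕ} (μ : Measure (Pt d)) : msupp μ = μ.support := by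
  ext x
  exact (nhds_basis_ball.mem_measureSupport).symm

lemma measure_compl_msupp {d : ℕ} (μ : Measure (Pt d)) : μ (msupp μ)ᶜ = 0 := by
  rw [msupp_eq_support]
  exact Measure.measure_compl_support

lemma integrable_of_lipschitz {d : ℕ} (μ : Measure (Pt d)) [IsLocallyFiniteMeasure μ]
    {ψ : Pt d → ℝ} (hc : HasCompactSupport ψ) (hL : ∃ K : NNReal, LipschitzWith K ψ) :
    Integrable ψ μ := by
  obtain ⟨K, hK⟩ := hL
  exact hK.continuous.integrable_of_hasCompactSupport hc

/-- Locally finite measures are determined by the integrals of compactly supported Lipschitz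
functions. -/
lemma ext_of_integral_lipschitz {d : ℕ} {μ ν : Measure (Pt d)} [IsLocallyFiniteMeasure μ]
    [IsLocallyFiniteMeasure ν]
    (h : ∀ ψ : Pt d → ℝ, HasCompactSupport ψ → (∃ K : NNReal, LipschitzWith K ψ) →
      ∫ y, ψ y ∂μ = ∫ y, ψ y ∂ν) : μ = ν := by
  have key : ∀ K : Set (Pt d), IsCompact K → μ K = ν K := by
    intro K hK
    rcases K.eq_empty_or_nonempty with rfl | hne
    · simp
    set F : ℕ → Pt d → ℝ := fun n y => max 0 (1 - (n + 1) * infDist y K) with hF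
    have hFL : ∀ n, ∃ K : NNReal, LipschitzWith K (F n) := by
      intro n
      refine ⟨n + 1, LipschitzWith.of_dist_le_mul fun x y => ?_⟩
      have h1 := (lipschitz_infDist_pt K).dist_le_mul x y
      rw [Real.dist_eq, NNReal.coe_one, one_mul] at h1
      have hn : (0 : ℝ) < n + 1 := by positivity
      rw [Real.dist_eq]
      calc |F n x - F n y| = |max (1 - (n + 1) * infDist x K) 0 -
              max (1 - (n + 1) * infDist y K) 0| := by
            simp only [hF, max_comm]
        _ ≤ |(1 - (n + 1) * infDist x K) - (1 - (n + 1) * infDist y K)| :=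
            abs_max_sub_max_le_abs _ _ _
        _ = (n + 1) * |infDist x K - infDist y K| := by
            rw [show (1 - (n + 1) * infDist x K) - (1 - (n + 1) * infDist y K) =
              -((n + 1) * (infDist x K - infDist y K)) by ring, abs_neg, abs_mul, abs_of_pos hn]
        _ ≤ _ := by
            push_cast
            gcongr
    have hF0 : ∀ n y, 1 ≤ infDist y K → F n y = 0 := by
      intro n y hy
      simp only [hF]
      apply max_eq_left
      nlinarith [(n.cast_nonneg : (0:ℝ) ≤ n)]
    have hFK : ∀ n y, y ∈ K → F n y = 1 := by
      intro n y hy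
      simp [hF, infDist_zero_of_mem hy]
    have hcomp : IsCompact (cthickening 1 K) := hK.cthickening
    have hFz : ∀ n y, y ∉ cthickening 1 K → F n y = 0 := by
      intro n y hy
      apply hF0
      by_contra hlt
      apply hy
      rw [hK.cthickening_eq_biUnion_closedBall zero_le_one]
      obtain ⟨z, hz, hz'⟩ := hK.exists_infDist_eq_dist hne y
      refine mem_biUnion hz ?_
      rw [mem_closedBall, ← hz']
      linarith
    have hFc : ∀ n, HasCompactSupport (F n) := fun n => HasCompactSupport.intro hcomp (hFz n)
    have hlim : ∀ (ρ : Measure (Pt d)) [IsLocallyFiniteMeasure ρ],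
        Tendsto (fun n => ∫ y, F n y ∂ρ) atTop (nhds (ρ.real K)) := by
      intro ρ _
      rw [← integral_indicator_one hK.measurableSet]
      refine tendsto_integral_of_dominated_convergence
        ((cthickening 1 K).indicator 1) ?_ ?_ ?_ ?_
      · exact fun n => (integrable_of_lipschitz ρ (hFc n) (hFL n)).aestronglyMeasurable
      · rw [integrable_indicator_iff hcomp.measurableSet]
        exact integrableOn_const hcomp.measure_lt_top.ne
      · intro n
        refine Eventually.of_forall fun y => ?_
        by_cases hy : y ∈ cthickening 1 K
        · rw [indicator_of_mem hy, Real.norm_eq_abs, abs_of_nonneg (le_max_left _ _)]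
          simp only [hF, Pi.one_apply, max_le_iff, zero_le_one, true_and]
          have : 0 ≤ ((n:ℝ) + 1) * infDist y K := mul_nonneg (by positivity) infDist_nonneg
          linarith
        · rw [indicator_of_notMem hy, hFz n y hy, norm_zero]
      · refine Eventually.of_forall fun y => ?_
        by_cases hy : y ∈ K
        · simp only [hFK _ _ hy, indicator_of_mem hy, Pi.one_apply]
          exact tendsto_const_nhds
        · rw [indicator_of_notMem hy]
          have hpos : 0 < infDist y K := (hK.isClosed.notMem_iff_infDist_pos hne).1 hy
          obtain ⟨N, hN⟩ := exists_nat_gt (1 / infDist y K)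
          refine tendsto_const_nhds.congr' ?_
          filter_upwards [eventually_ge_atTop N] with n hn
          have : (N:ℝ) ≤ n := by exact_mod_cast hn
          rw [div_lt_iff₀ hpos] at hN
          simp only [hF]
          symm
          apply max_eq_left
          nlinarith
    have := tendsto_nhds_unique (hlim μ) ((hlim ν).congr fun n => (h _ (hFc n) (hFL n)).symm)
    exact (measureReal_eq_measureReal_iff hK.measure_lt_top.ne hK.measure_lt_top.ne).1 this
  refine Measure.OuterRegular.ext_isOpen fun U hU => ?_
  rw [hU.measure_eq_iSup_isCompact, hU.measure_eq_iSup_isCompact]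
  refine iSup_congr fun K => iSup_congr fun _ => iSup_congr fun hK => key K hK

/-- The cone of height and radius `R`. -/
def cone {d : ℕ} (R : ℝ) (y : Pt d) : ℝ := max 0 (R - ‖y‖)

/-- The mass of `μ` near `z`, smoothed by a cone of radius `R`. -/
def coneMass {d : ℕ} (μ : Measure (Pt d)) (R : ℝ) (z : Pt d) : ℝ := ∫ y, cone R (y - z) ∂μ

lemma cone_nonneg {d : ℕ} (R : ℝ) (y : Pt d) : 0 ≤ cone R y := le_max_left _ _

lemma lipschitz_cone_sub {d : ℕ} (R : ℝ) (z : Pt d) :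
    LipschitzWith 1 (fun y : Pt d => cone R (y - z)) := by
  refine LipschitzWith.of_dist_le_mul fun x y => ?_
  rw [Real.dist_eq, NNReal.coe_one, one_mul]
  simp only [cone, max_comm (0 : ℝ)]
  refine (abs_max_sub_max_le_abs _ _ _).trans ?_
  rw [show R - ‖x - z‖ - (R - ‖y - z‖) = -(‖x - z‖ - ‖y - z‖) by ring, abs_neg]
  refine (abs_norm_sub_norm_le _ _).trans ?_
  rw [dist_eq_norm, sub_sub_sub_cancel_right]

lemma cone_sub_eq_zero {d : ℕ} {R : ℝ} {y z : Pt d} (h : y ∉ closedBall z R) :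
    cone R (y - z) = 0 := by
  rw [mem_closedBall, dist_eq_norm, not_le] at h
  exact max_eq_left (by linarith)

lemma hasCompactSupport_cone_sub {d : ℕ} (R : ℝ) (z : Pt d) :
    HasCompactSupport (fun y : Pt d => cone R (y - z)) :=
  HasCompactSupport.intro (isCompact_closedBall z R) fun _ hy => cone_sub_eq_zero hy

lemma integrable_cone_sub {d : ℕ} (μ : Measure (Pt d)) [IsLocallyFiniteMeasure μ] (R : ℝ)
    (z : Pt d) : Integrable (fun y : Pt d => cone R (y - z)) μ :=
  integrable_of_lipschitz μ (hasCompactSupport_cone_sub R z) ⟨1, lipschitz_cone_sub R z⟩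

lemma coneMass_nonneg {d : ℕ} (μ : Measure (Pt d)) (R : ℝ) (z : Pt d) : 0 ≤ coneMass μ R z :=
  integral_nonneg fun _ => cone_nonneg _ _

lemma coneMass_le {d : ℕ} (μ : Measure (Pt d)) [IsLocallyFiniteMeasure μ] {R : ℝ} (hR : 0 ≤ R)
    {z x : Pt d} {ρ : ℝ} (h : dist z x ≤ ρ) :
    coneMass μ R z ≤ R * μ.real (closedBall x (ρ + R)) := by
  have hm : MeasurableSet (closedBall x (ρ + R)) := isClosed_closedBall.measurableSet
  have : R * μ.real (closedBall x (ρ + R)) =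
      ∫ y, (closedBall x (ρ + R)).indicator (fun _ => R) y ∂μ := by
    rw [integral_indicator_const _ hm, smul_eq_mul, mul_comm]
  rw [this]
  refine integral_mono (integrable_cone_sub μ R z) ?_ fun y => ?_
  · rw [integrable_indicator_iff hm]
    exact integrableOn_const (isCompact_closedBall x (ρ + R)).measure_lt_top.ne
  · by_cases hy : y ∈ closedBall x (ρ + R)
    · rw [indicator_of_mem hy]
      exact max_le hR (by linarith [norm_nonneg (y - z)])
    · rw [indicator_of_notMem hy]
      refine (cone_sub_eq_zero fun hy' => hy ?_).le
      rw [mem_closedBall] at hy' ⊢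
      linarith [dist_triangle y z x]

lemma mul_measure_ball_le_coneMass {d : ℕ} (μ : Measure (Pt d)) [IsLocallyFiniteMeasure μ] {R : ℝ}
    (z : Pt d) : R * μ.real (closedBall z R) ≤ coneMass μ (2 * R) z := by
  have hm : MeasurableSet (closedBall z R) := isClosed_closedBall.measurableSet
  have : R * μ.real (closedBall z R) = ∫ y, (closedBall z R).indicator (fun _ => R) y ∂μ := by
    rw [integral_indicator_const _ hm, smul_eq_mul, mul_comm]
  rw [this]
  refine integral_mono ?_ (integrable_cone_sub μ _ z) fun y => ?_
  · rw [integrable_indicator_iff hm]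
    exact integrableOn_const (isCompact_closedBall z R).measure_lt_top.ne
  · by_cases hy : y ∈ closedBall z R
    · rw [indicator_of_mem hy]
      rw [mem_closedBall, dist_eq_norm] at hy
      exact le_max_of_le_right (by linarith)
    · rw [indicator_of_notMem hy]
      exact cone_nonneg _ _

lemma SmoothlyReflectionless.coneMass_sub {d : ℕ} {μ : Measure (Pt d)} [IsLocallyFiniteMeasure μ]
    (hμ : SmoothlyReflectionless μ) (R : ℝ) {x x' : Pt d} (hx : x ∈ msupp μ) (hx' : x' ∈ msupp μ)
    (a : Pt d) :
    coneMass μ R (x + a) - coneMass μ R (x - a) =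
      coneMass μ R (x' + a) - coneMass μ R (x' - a) := by
  obtain ⟨Λ, hΛ⟩ := hμ (fun y => cone R (y - a) - cone R (y - -a)) (fun y => by
      simp only [cone]
      rw [← norm_neg (-y - a), ← norm_neg (-y - -a), neg_sub (max _ _)]
      congr 4 <;> abel_nf)
    ((hasCompactSupport_cone_sub R a).sub (hasCompactSupport_cone_sub R (-a)))
    ⟨1 + 1, (lipschitz_cone_sub R a).sub (lipschitz_cone_sub R (-a))⟩
  have key : ∀ z ∈ msupp μ, coneMass μ R (z + a) - coneMass μ R (z - a) = -Λ := by
    intro z hz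
    rw [← hΛ z hz, coneMass, coneMass, ← integral_sub (integrable_cone_sub μ R _)
      (integrable_cone_sub μ R _), ← integral_neg]
    congr 1
    ext y
    simp only [cone]
    rw [← norm_neg (z - y - a), ← norm_neg (z - y - -a), neg_sub (max _ _)]
    congr 4 <;> abel_nf
  rw [key x hx, key x' hx']

/-- Translating along a difference of two points of the support keeps the smoothed mass bounded. -/
lemma SmoothlyReflectionless.coneMass_add_zsmul_le {d : ℕ} {μ : Measure (Pt d)}
    [IsLocallyFiniteMeasure μ] (hμ : SmoothlyReflectionless μ) (R : ℝ) {x h : Pt d}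
    (hx : x ∈ msupp μ) (hh : x + h ∈ msupp μ) (z : Pt d) (n : ℤ) :
    coneMass μ R (x + z + n • h) ≤ coneMass μ R (x + z) + coneMass μ R (x + h - z) := by
  have step : ∀ a, coneMass μ R (x + h + a) + coneMass μ R (x - a) =
      coneMass μ R (x + a) + coneMass μ R (x + h - a) := by
    intro a
    linarith [hμ.coneMass_sub R hx hh a]
  have per : ∀ k : ℤ, coneMass μ R (x + z + k • h) + coneMass μ R (x + h - z - k • h) =
      coneMass μ R (x + z) + coneMass μ R (x + h - z) := by
    have succ : ∀ k : ℤ, coneMass μ R (x + z + (k + 1) • h) +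
        coneMass μ R (x + h - z - (k + 1) • h) =
        coneMass μ R (x + z + k • h) + coneMass μ R (x + h - z - k • h) := by
      intro k
      have := step (z + k • h)
      convert this using 3 <;> module
    intro k
    induction k using Int.induction_on with
    | zero => simp
    | succ i ih => rw [succ, ih]
    | pred i ih => rw [← ih, ← succ (-(i : ℤ) - 1), sub_add_cancel]
  linarith [per n, coneMass_nonneg μ R (x + h - z - n • h)]

/-- The smoothed mass is bounded on the support. -/
lemma SmoothlyReflectionless.exists_coneMass_le {d : ℕ} {μ : Measure (Pt d)}
    [IsLocallyFiniteMeasure μ] (hμ : SmoothlyReflectionless μ) {R : ℝ} (hR : 0 ≤ R) :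
    ∃ C, ∀ y ∈ msupp μ, coneMass μ R y ≤ C := by
  rcases (msupp μ).eq_empty_or_nonempty with he | ⟨x, hx⟩
  · exact ⟨0, by simp [he]⟩
  have fin : ∀ s : Finset (Pt d), (∀ h ∈ s, x + h ∈ msupp μ) → ∀ ρ : ℝ, ∃ C,
      ∀ v ∈ Submodule.span ℝ (s : Set (Pt d)), ∀ w, ‖w‖ ≤ ρ → coneMass μ R (x + (w + v)) ≤ C := by
    classical
    intro s
    induction s using Finset.induction_on with
    | empty =>
      intro _ ρ
      refine ⟨R * μ.real (closedBall x (ρ + R)), fun v hv w hw => ?_⟩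
      simp only [Finset.coe_empty, Submodule.span_empty, Submodule.mem_bot] at hv
      subst hv
      exact coneMass_le μ hR (by simpa [dist_eq_norm] using hw)
    | insert h s _ ih =>
      intro hs ρ
      obtain ⟨C₁, hC₁⟩ := ih (fun g hg => hs g (Finset.mem_insert_of_mem hg)) (ρ + ‖h‖)
      obtain ⟨C₂, hC₂⟩ := ih (fun g hg => hs g (Finset.mem_insert_of_mem hg)) (ρ + ‖h‖ + ‖h‖)
      refine ⟨C₁ + C₂, fun v hv w hw => ?_⟩
      rw [Finset.coe_insert, Submodule.mem_span_insert] at hv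
      obtain ⟨t, v, hv, rfl⟩ := hv
      have hw' : ‖w + Int.fract t • h‖ ≤ ρ + ‖h‖ := by
        refine (norm_add_le _ _).trans (add_le_add hw ?_)
        rw [norm_smul, Real.norm_eq_abs, abs_of_nonneg (Int.fract_nonneg t)]
        exact mul_le_of_le_one_left (norm_nonneg _) (Int.fract_lt_one t).le
      have h1 := hμ.coneMass_add_zsmul_le R hx (hs h (Finset.mem_insert_self h s))
        (w + Int.fract t • h + v) ⌊t⌋
      have h2 := hC₁ v hv _ hw'
      have h3 := hC₂ (-v) (neg_mem hv) (h - (w + Int.fract t • h))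
        ((norm_sub_le _ _).trans (by linarith))
      have e1 : x + (w + Int.fract t • h + v) + ⌊t⌋ • h = x + (w + (t • h + v)) := by
        have : t • h = Int.fract t • h + ⌊t⌋ • h := by
          rw [← Int.cast_smul_eq_zsmul ℝ ⌊t⌋ h, ← add_smul, Int.fract_add_floor]
        rw [this]
        abel
      have e2 : x + h - (w + Int.fract t • h + v) = x + (h - (w + Int.fract t • h) + -v) := by abel
      rw [e1, e2] at h1
      linarith
  have hfg := IsNoetherian.noetherian (Submodule.span ℝ ((fun y => y - x) '' msupp μ))
  obtain ⟨s, hs, hspan⟩ := Submodule.fg_span_iff_fg_span_finset_subset _ |>.1 hfg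
  obtain ⟨C, hC⟩ := fin s (fun h hh => by
    obtain ⟨y, hy, rfl⟩ := hs hh
    simpa using hy) 0
  refine ⟨C, fun y hy => ?_⟩
  have := hC (y - x) (hspan ▸ Submodule.subset_span ⟨y, hy, rfl⟩) 0 (by simp)
  simpa using this

/-- Balls of a fixed radius have uniformly bounded measure. -/
lemma SmoothlyReflectionless.exists_measure_closedBall_le {d : ℕ} {μ : Measure (Pt d)}
    [IsLocallyFiniteMeasure μ] (hμ : SmoothlyReflectionless μ) {R : ℝ} (hR : 0 < R) :
    ∃ C, 0 ≤ C ∧ ∀ z, μ.real (closedBall z R) ≤ C := by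
  obtain ⟨C, hC⟩ := hμ.exists_coneMass_le (R := 2 * (2 * R)) (by linarith)
  refine ⟨max 0 (C / (2 * R)), le_max_left _ _, fun z => ?_⟩
  rcases (closedBall z R ∩ msupp μ).eq_empty_or_nonempty with he | ⟨y, hyz, hy⟩
  · have h0 : μ (closedBall z R) = 0 := by
      refine measure_mono_null (t := (msupp μ)ᶜ) (fun w hw hw' => ?_) (measure_compl_msupp μ)
      exact eq_empty_iff_forall_notMem.1 he w ⟨hw, hw'⟩
    simp [Measure.real, h0]
  · refine le_max_of_le_right ?_
    rw [le_div_iff₀ (by linarith)]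
    have h1 : μ.real (closedBall z R) ≤ μ.real (closedBall y (2 * R)) := by
      refine measureReal_mono (fun w hw => ?_) (isCompact_closedBall _ _).measure_lt_top.ne
      rw [mem_closedBall] at hw hyz ⊢
      rw [dist_comm] at hyz
      linarith [dist_triangle w z y]
    have h2 := mul_measure_ball_le_coneMass μ (R := 2 * R) y
    nlinarith [hC y hy]

/-- A measure with uniformly bounded mass on balls of radius `R` has polynomial growth. -/
lemma measure_closedBall_le_of_forall_le {d : ℕ} (μ : Measure (Pt d)) [IsLocallyFiniteMeasure μ]
    {R C : ℝ} (hR : 0 < R) (hC0 : 0 ≤ C) (hC : ∀ z, μ.real (closedBall z R) ≤ C) (n : ℕ) :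
    μ.real (closedBall 0 (n * R)) ≤ C * (n + 1) ^ d := by
  set B : Set (Pt d) := closedBall 0 (n * R)
  set T : Set (Pt d × Pt d) := {p | dist p.1 p.2 ≤ R}
  have hT : MeasurableSet T := (isClosed_le continuous_dist continuous_const).measurableSet
  have h1 : ((μ.restrict B).prod volume) T = μ B * volume (closedBall (0 : Pt d) R) := by
    rw [Measure.prod_apply hT]
    have : ∀ y : Pt d, volume (Prod.mk y ⁻¹' T) = volume (closedBall (0 : Pt d) R) := by
      intro y
      rw [← Measure.addHaar_closedBall_center volume y R]
      congr 1
      ext z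
      simp [T, dist_comm]
    simp_rw [this]
    rw [lintegral_const, Measure.restrict_apply_univ, mul_comm]
  have h2 : ((μ.restrict B).prod volume) T ≤
      ENNReal.ofReal C * volume (closedBall (0 : Pt d) ((n + 1) * R)) := by
    rw [Measure.prod_apply_symm hT]
    calc ∫⁻ z, μ.restrict B ((fun y => (y, z)) ⁻¹' T)
        ≤ ∫⁻ z, (closedBall (0 : Pt d) ((n + 1) * R)).indicator (fun _ => ENNReal.ofReal C) z := by
          refine lintegral_mono fun z => ?_
          by_cases hz : z ∈ closedBall (0 : Pt d) ((n + 1) * R)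
          · rw [indicator_of_mem hz]
            refine (Measure.restrict_apply_le _ _).trans ?_
            have : ((fun y => (y, z)) ⁻¹' T) = closedBall z R := by
              ext y
              simp [T]
            rw [this, ← ENNReal.ofReal_toReal (isCompact_closedBall z R).measure_lt_top.ne]
            exact ENNReal.ofReal_le_ofReal (hC z)
          · rw [indicator_of_notMem hz, nonpos_iff_eq_zero,
              Measure.restrict_apply (measurable_prodMk_right hT)]
            convert measure_empty (μ := μ)
            refine eq_empty_of_forall_notMem fun y hy => hz ?_
            have hy1 : dist y z ≤ R := hy.1
            have hy2 : dist y 0 ≤ n * R := hy.2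
            rw [mem_closedBall]
            rw [dist_comm] at hy1
            linarith [dist_triangle z y 0]
      _ = _ := lintegral_indicator_const isClosed_closedBall.measurableSet _
  rw [h1, Measure.addHaar_closedBall volume _ hR.le,
    Measure.addHaar_closedBall volume _ (by positivity), finrank_euclideanSpace_fin,
    ← mul_assoc, ← mul_assoc] at h2
  have hv0 : volume (ball (0 : Pt d) 1) ≠ 0 := (measure_ball_pos _ _ one_pos).ne'
  have h3 := (ENNReal.mul_le_mul_iff_left hv0 measure_ball_lt_top.ne).1 h2
  have h4 := ENNReal.toReal_mono (by finiteness) h3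
  rw [ENNReal.toReal_mul, ENNReal.toReal_mul, ENNReal.toReal_ofReal (by positivity),
    ENNReal.toReal_ofReal hC0, ENNReal.toReal_ofReal (by positivity), mul_pow, ← mul_assoc] at h4
  exact le_of_mul_le_mul_right h4 (by positivity)

lemma eq_zero_of_mul_le_succ_of_le_pow {a : ℕ → ℝ} {C q : ℝ} {d : ℕ} (ha : ∀ n, 0 ≤ a n)
    (hq : 1 < q) (hstep : ∀ n, q * a n ≤ a (n + 1)) (hC : ∀ n : ℕ, a n ≤ C * (n + 1) ^ d) (n : ℕ) :
    a n = 0 := by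
  have hq0 : 0 < q := by linarith
  have h1 : ∀ k, q ^ k * a n ≤ a (k + n) := by
    intro k
    induction k with
    | zero => simp
    | succ k ih =>
      calc q ^ (k + 1) * a n = q * (q ^ k * a n) := by ring
        _ ≤ q * a (k + n) := by gcongr
        _ ≤ a (k + n + 1) := hstep _
        _ = a (k + 1 + n) := by congr 1; omega
  have h2 : Tendsto
      (fun k : ℕ => C * q ^ (n + 1) * (((k + (n + 1) : ℕ) : ℝ) ^ d / q ^ (k + (n + 1))))
      atTop (nhds (C * q ^ (n + 1) * 0)) :=
    ((tendsto_pow_const_div_const_pow_of_one_lt d hq).comp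
      (tendsto_add_atTop_nat (n + 1))).const_mul _
  rw [mul_zero] at h2
  refine le_antisymm (ge_of_tendsto' h2 fun k => ?_) (ha n)
  have h3 := (h1 k).trans (hC (k + n))
  have : C * q ^ (n + 1) * (((k + (n + 1) : ℕ) : ℝ) ^ d / q ^ (k + (n + 1))) =
      C * (((k + n : ℕ) : ℝ) + 1) ^ d / q ^ k := by
    push_cast
    field_simp
    ring
  rw [this, le_div_iff₀ (by positivity)]
  linarith

/-- The constants in the definition of a smoothly reflectionless measure vanish. -/
lemma SmoothlyReflectionless.integral_eq_zero {d : ℕ} {μ : Measure (Pt d)}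
    [IsLocallyFiniteMeasure μ] (hμ : SmoothlyReflectionless μ) {φ : Pt d → ℝ}
    (hodd : ∀ x, φ (-x) = -φ x) (hc : HasCompactSupport φ) (hL : ∃ K : NNReal, LipschitzWith K φ)
    {x₀ : Pt d} (hx₀ : x₀ ∈ msupp μ) : ∫ y, φ (x₀ - y) ∂μ = 0 := by
  obtain ⟨Λ, hΛ⟩ := hμ φ hodd hc hL
  rw [hΛ x₀ hx₀]
  by_contra hne
  have hcont : Continuous φ := hL.choose_spec.continuous
  obtain ⟨Q, hQ⟩ := hc.exists_bound_of_continuous hcont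
  obtain ⟨R, hR, hsupp⟩ : ∃ R, 0 < R ∧ ∀ y, R < ‖y‖ → φ y = 0 := by
    obtain ⟨R, hR, h⟩ := hc.isCompact.isBounded.exists_pos_norm_le
    refine ⟨R, hR, fun y hy => ?_⟩
    by_contra h0
    exact absurd (h y (subset_tsupport φ h0)) (not_le.2 hy)
  obtain ⟨M, hM0, hM⟩ := hμ.exists_measure_closedBall_le hR
  have hQ0 : 0 ≤ Q := (norm_nonneg _).trans (hQ 0)
  set a : ℕ → ℝ := fun n => μ.real (closedBall 0 (n * R)) with ha
  have hint : ∀ x, Integrable (fun y => φ (x - y)) μ := fun x =>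
    (hcont.comp (continuous_const.sub continuous_id)).integrable_of_hasCompactSupport
      (hc.comp_homeomorph (Homeomorph.subLeft x))
  have hmono : ∀ n, a n ≤ a (n + 1) := by
    intro n
    refine measureReal_mono (closedBall_subset_closedBall ?_)
      (isCompact_closedBall _ _).measure_lt_top.ne
    push_cast
    linarith
  have hflux : ∀ n, |Λ| * a (n + 1) ≤ (Q * M + 1) * (a (n + 1) - a n) := by
    intro n
    set B : Set (Pt d) := closedBall 0 ((n + 1 : ℕ) * R) with hB
    have hBm : MeasurableSet B := isClosed_closedBall.measurableSet
    have hBfin : μ B < ⊤ := (isCompact_closedBall _ _).measure_lt_top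
    have : IsFiniteMeasure (μ.restrict B) := ⟨by simpa using hBfin⟩
    have hprod : Integrable (fun p : Pt d × Pt d => φ (p.1 - p.2))
        ((μ.restrict B).prod (μ.restrict B)) :=
      Integrable.of_bound (hcont.comp (continuous_fst.sub continuous_snd)).aestronglyMeasurable Q
        (Eventually.of_forall fun p => hQ _)
    set J : Pt d → ℝ := fun x => ∫ y in B, φ (x - y) ∂μ with hJ
    have hJint : Integrable J (μ.restrict B) := hprod.integral_prod_left
    have hJ0 : ∫ x in B, J x ∂μ = 0 := by
      have h1 : ∫ x in B, J x ∂μ = ∫ y in B, ∫ x in B, φ (x - y) ∂μ ∂μ :=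
        integral_integral_swap hprod
      have h2 : ∫ y in B, ∫ x in B, φ (x - y) ∂μ ∂μ = -∫ x in B, J x ∂μ := by
        rw [← integral_neg]
        congr 1
        ext y
        rw [hJ, ← integral_neg]
        congr 1
        ext x
        rw [← hodd, neg_sub]
      linarith
    have hΛB : ∫ x in B, (Λ - J x) ∂μ = Λ * a (n + 1) := by
      rw [integral_sub (integrable_const _) hJint, hJ0, sub_zero, setIntegral_const, smul_eq_mul,
        mul_comm]
    set D : Set (Pt d) := B \ closedBall 0 (n * R) with hD
    have hDm : MeasurableSet D := hBm.diff isClosed_closedBall.measurableSet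
    have hbound : ∀ᵐ x ∂(μ.restrict B), ‖Λ - J x‖ ≤ D.indicator (fun _ => Q * M) x := by
      have hS : ∀ᵐ x ∂(μ.restrict B), x ∈ msupp μ :=
        ae_restrict_of_ae (measure_compl_msupp μ)
      filter_upwards [hS, ae_restrict_mem hBm] with x hx hxB
      have hsplit : Λ - J x = ∫ y in Bᶜ, φ (x - y) ∂μ := by
        rw [← hΛ x hx, ← integral_add_compl hBm (hint x), hJ]
        ring
      rw [hsplit]
      by_cases hxn : x ∈ closedBall (0 : Pt d) (n * R)
      · rw [indicator_of_notMem (fun h => h.2 hxn), setIntegral_eq_zero_of_forall_eq_zero, norm_zero]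
        intro y hy
        apply hsupp
        rw [mem_compl_iff, hB, mem_closedBall, not_le, dist_zero_right] at hy
        rw [mem_closedBall, dist_zero_right] at hxn
        push_cast at hy
        have := norm_sub_norm_le y x
        rw [norm_sub_rev] at this
        linarith
      · rw [indicator_of_mem (show x ∈ D from ⟨hxB, hxn⟩)]
        calc ‖∫ y in Bᶜ, φ (x - y) ∂μ‖
            ≤ ∫ y, (closedBall x R).indicator (fun _ => Q) y ∂μ := by
              rw [← integral_indicator hBm.compl]
              refine norm_integral_le_of_norm_le ?_ (Eventually.of_forall fun y => ?_)
              · rw [integrable_indicator_iff isClosed_closedBall.measurableSet]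
                exact integrableOn_const (isCompact_closedBall x R).measure_lt_top.ne
              · refine (norm_indicator_le_norm_self _ _).trans ?_
                by_cases hy : y ∈ closedBall x R
                · rw [indicator_of_mem hy]
                  exact hQ _
                · rw [indicator_of_notMem hy, hsupp, norm_zero]
                  rw [mem_closedBall, not_le, dist_comm, dist_eq_norm] at hy
                  exact hy
          _ = Q * μ.real (closedBall x R) := by
              rw [integral_indicator_const _ isClosed_closedBall.measurableSet, smul_eq_mul,
                mul_comm]
          _ ≤ Q * M := by gcongr; exact hM x
    have hDint : Integrable (D.indicator (fun _ => Q * M)) (μ.restrict B) :=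
      (integrable_const _).indicator hDm
    have h3 := norm_integral_le_of_norm_le hDint hbound
    rw [hΛB, integral_indicator_const _ hDm, smul_eq_mul, norm_mul, Real.norm_eq_abs,
      Real.norm_eq_abs, abs_of_nonneg measureReal_nonneg, measureReal_restrict_apply hDm,
      inter_eq_self_of_subset_left sdiff_subset,
      measureReal_sdiff (closedBall_subset_closedBall (by push_cast; linarith))
        isClosed_closedBall.measurableSet hBfin.ne] at h3
    have h4 : 0 ≤ a (n + 1) - a n := sub_nonneg.2 (hmono n)
    change |Λ| * a (n + 1) ≤ (a (n + 1) - a n) * (Q * M) at h3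
    linarith
  have hT : 0 < Q * M + 1 := by positivity
  have hzero := eq_zero_of_mul_le_succ_of_le_pow (a := a) (q := 1 + |Λ| / (Q * M + 1))
    (fun n => measureReal_nonneg) (by have := abs_pos.2 hne; simp; positivity)
    (fun n => by
      have h1 := hflux n
      have h2 : |Λ| * a n ≤ |Λ| * a (n + 1) := by gcongr; exact hmono n
      have h3 : (Q * M + 1) * ((1 + |Λ| / (Q * M + 1)) * a n) ≤ (Q * M + 1) * a (n + 1) := by
        have : (Q * M + 1) * ((1 + |Λ| / (Q * M + 1)) * a n) = (Q * M + 1) * a n + |Λ| * a n := by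
          field_simp
        linarith
      exact le_of_mul_le_mul_left h3 hT)
    (measure_closedBall_le_of_forall_le μ hR hM0 hM)
  obtain ⟨n, hn⟩ := exists_nat_gt ((‖x₀‖ + 1) / R)
  rw [div_lt_iff₀ hR] at hn
  have hpos := hx₀ 1 one_pos
  refine absurd (measure_mono_null ?_ ((measureReal_eq_zero_iff
    (isCompact_closedBall _ _).measure_lt_top.ne).1 (hzero n))) hpos.ne'
  intro y hy
  rw [mem_ball] at hy
  rw [mem_closedBall]
  linarith [dist_triangle y x₀ 0, dist_zero_right x₀]

/-- A smoothly reflectionless measure is symmetric about each point of its support. -/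
lemma SmoothlyReflectionless.map_reflection {d : ℕ} {μ : Measure (Pt d)}
    [IsLocallyFiniteMeasure μ] (hμ : SmoothlyReflectionless μ) {x : Pt d} (hx : x ∈ msupp μ) :
    μ.map (fun y => (2 : ℝ) • x - y) = μ := by
  have : IsFiniteMeasureOnCompacts (μ.map (fun y => (2 : ℝ) • x - y)) :=
    Measure.IsFiniteMeasureOnCompacts.map μ (Homeomorph.subLeft ((2 : ℝ) • x))
  refine ext_of_integral_lipschitz fun ψ hc hL => ?_
  have hcont : Continuous ψ := hL.choose_spec.continuous
  rw [integral_map (by fun_prop) hcont.aestronglyMeasurable]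
  obtain ⟨K, hK⟩ := hL
  have hK' : LipschitzWith K fun u => ψ (x + u) :=
    LipschitzWith.of_dist_le_mul fun u v => by simpa using hK.dist_le_mul (x + u) (x + v)
  have hK'' : LipschitzWith K fun u => ψ (x - u) :=
    LipschitzWith.of_dist_le_mul fun u v => by
      simpa only [dist_sub_left] using hK.dist_le_mul (x - u) (x - v)
  have h := hμ.integral_eq_zero (φ := fun u => ψ (x + u) - ψ (x - u))
    (fun u => by simp [sub_eq_add_neg])
    ((hc.comp_homeomorph (Homeomorph.addLeft x)).sub (hc.comp_homeomorph (Homeomorph.subLeft x)))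
    ⟨K + K, hK'.sub hK''⟩ hx
  have e : ∀ y, ψ (x + (x - y)) - ψ (x - (x - y)) = ψ ((2 : ℝ) • x - y) - ψ y := by
    intro y
    rw [sub_sub_cancel, two_smul, add_sub_assoc]
  simp only [e] at h
  rw [integral_sub ?_ ?_] at h
  · linarith
  · exact (hcont.comp (continuous_const.sub continuous_id)).integrable_of_hasCompactSupport
      (hc.comp_homeomorph (Homeomorph.subLeft ((2 : ℝ) • x)))
  · exact hcont.integrable_of_hasCompactSupport hc

lemma add_mem_msupp_of_map_eq {d : ℕ} {μ : Measure (Pt d)} {T : Pt d → Pt d} (hT : Isometry T)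
    (hμ : μ.map T = μ) {x : Pt d} (hx : x ∈ msupp μ) : T x ∈ msupp μ := by
  intro r hr
  rw [← hμ, Measure.map_apply hT.continuous.measurable isOpen_ball.measurableSet,
    hT.preimage_ball]
  exact hx r hr

/-- The group of translations preserving `μ`. -/
def periods {d : ℕ} (μ : Measure (Pt d)) : AddSubgroup (Pt d) where
  carrier := {v | μ.map (fun y => y + v) = μ}
  zero_mem' := by simp
  add_mem' := by
    intro v w hv hw
    have hv' : μ.map (fun y => y + v) = μ := hv
    have hw' : μ.map (fun y => y + w) = μ := hw
    change μ.map (fun y => y + (v + w)) = μ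
    conv_rhs => rw [← hw', ← hv']
    rw [Measure.map_map (by fun_prop) (by fun_prop)]
    congr 1
    ext1 y
    simp [add_assoc]
  neg_mem' := by
    intro v hv
    have hv' : μ.map (fun y => y + v) = μ := hv
    change μ.map (fun y => y + -v) = μ
    conv_lhs => rw [← hv']
    rw [Measure.map_map (by fun_prop) (by fun_prop)]
    convert Measure.map_id (μ := μ)
    ext1 y
    simp

lemma mem_periods {d : ℕ} {μ : Measure (Pt d)} {v : Pt d} :
    v ∈ periods μ ↔ μ.map (fun y => y + v) = μ := Iff.rfl

lemma isClosed_periods {d : ℕ} (μ : Measure (Pt d)) [IsLocallyFiniteMeasure μ] :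
    IsClosed (periods μ : Set (Pt d)) := by
  refine IsSeqClosed.isClosed fun u v hu huv => ?_
  change μ.map (fun y => y + v) = μ
  have hmap : IsFiniteMeasureOnCompacts (μ.map (fun y => y + v)) :=
    Measure.IsFiniteMeasureOnCompacts.map μ (Homeomorph.addRight v)
  refine ext_of_integral_lipschitz fun ψ hc hL => ?_
  have hcont : Continuous ψ := hL.choose_spec.continuous
  have hint : ∀ w, ∫ y, ψ y ∂(μ.map (fun y => y + w)) = ∫ y, ψ (y + w) ∂μ := fun w =>
    integral_map (by fun_prop) hcont.aestronglyMeasurable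
  rw [hint]
  obtain ⟨r, hr⟩ := hc.isCompact.isBounded.exists_norm_le
  have hcontOn : ContinuousOn (fun w => ∫ y, ψ (y + w) ∂μ) (closedBall v 1) := by
    refine continuousOn_integral_of_compact_support
      (isCompact_closedBall (0 : Pt d) (r + ‖v‖ + 1)) ?_ ?_
    · exact (hcont.comp (continuous_snd.add continuous_fst)).continuousOn
    · intro w y hw hy
      by_contra h0
      apply hy
      have h1 := hr _ (subset_tsupport ψ h0)
      rw [mem_closedBall, dist_eq_norm] at hw
      rw [mem_closedBall, dist_zero_right]
      have h2 : ‖y‖ ≤ ‖y + w‖ + ‖w - v‖ + ‖v‖ := by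
        calc ‖y‖ = ‖(y + w) - (w - v) - v‖ := by congr 1; abel
          _ ≤ _ := (norm_sub_le _ _).trans (by gcongr; exact norm_sub_le _ _)
      linarith
  have hat := (hcontOn.continuousAt (closedBall_mem_nhds v one_pos)).tendsto.comp huv
  refine tendsto_nhds_unique hat (tendsto_const_nhds.congr fun n => ?_)
  have hun : μ.map (fun y => y + u n) = μ := hu n
  change _ = ∫ y, ψ (y + u n) ∂μ
  rw [← hint, hun]

/-- A closed subgroup of Euclidean space contains a subspace, transversally to which it is
uniformly discrete. -/
lemma exists_submodule_le_of_isClosed {d : ℕ} (G : AddSubgroup (Pt d))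
    (hG : IsClosed (G : Set (Pt d))) :
    ∃ V : Submodule ℝ (Pt d), (∀ v ∈ V, v ∈ G) ∧
      ∃ δ : ℝ, 0 < δ ∧ ∀ g ∈ G, g ∈ Vᗮ → ‖g‖ < δ → g = 0 := by
  let V : Submodule ℝ (Pt d) :=
    { carrier := {v | ∀ t : ℝ, t • v ∈ G}
      zero_mem' := fun t => by simp [zero_mem]
      add_mem' := fun {v w} hv hw t => by
        rw [smul_add]
        exact add_mem (hv t) (hw t)
      smul_mem' := fun c v hv t => by
        rw [smul_smul]
        exact hv _ }
  refine ⟨V, fun v hv => by simpa using hv 1, ?_⟩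
  by_contra! hcon
  choose g hgG hgV hgδ hg0 using fun n : ℕ =>
    hcon (1 / ((n : ℝ) + 1)) Nat.one_div_pos_of_nat
  have hgpos : ∀ n, 0 < ‖g n‖ := fun n => norm_pos_iff.2 (hg0 n)
  have hlim : Tendsto (fun n => ‖g n‖) atTop (nhds 0) :=
    squeeze_zero (fun n => norm_nonneg _) (fun n => (hgδ n).le)
      tendsto_one_div_add_atTop_nhds_zero_nat
  obtain ⟨u, hu, σ, hσ, hσu⟩ := (isCompact_sphere (0 : Pt d) 1).tendsto_subseq
    (x := fun n => ‖g n‖⁻¹ • g n) (fun n => by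
      rw [mem_sphere_zero_iff_norm, norm_smul, norm_inv, norm_norm,
        inv_mul_cancel₀ (hgpos n).ne'])
  have huV : u ∈ V := by
    intro t
    have h1 : Tendsto (fun n => Int.fract (t / ‖g (σ n)‖) • g (σ n)) atTop (nhds 0) := by
      refine squeeze_zero_norm (fun n => ?_) (hlim.comp hσ.tendsto_atTop)
      rw [norm_smul, Real.norm_eq_abs, abs_of_nonneg (Int.fract_nonneg _)]
      exact mul_le_of_le_one_left (norm_nonneg _) (Int.fract_lt_one _).le
    have h2 := (hσu.const_smul t).sub h1
    rw [sub_zero] at h2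
    refine hG.mem_of_tendsto h2 (Eventually.of_forall fun n => ?_)
    have : t • (‖g (σ n)‖⁻¹ • g (σ n)) - Int.fract (t / ‖g (σ n)‖) • g (σ n) =
        ⌊t / ‖g (σ n)‖⌋ • g (σ n) := by
      rw [smul_smul, ← div_eq_mul_inv, ← sub_smul, Int.self_sub_fract, Int.cast_smul_eq_zsmul]
    simp only [Function.comp_apply, this]
    exact zsmul_mem (hgG _) _
  have huV' : u ∈ Vᗮ :=
    (Submodule.isClosed_orthogonal V).mem_of_tendsto hσu
      (Eventually.of_forall fun n => Submodule.smul_mem _ _ (hgV _))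
  have : u = 0 := by
    have := Submodule.inner_right_of_mem_orthogonal huV huV'
    exact inner_self_eq_zero.1 this
  rw [mem_sphere_zero_iff_norm, this, norm_zero] at hu
  exact zero_ne_one hu

/-- On an affine subspace whose direction consists of periods of `μ`, the measure `μ` is a multiple
of the Hausdorff measure. -/
lemma exists_measure_inter_eq_hausdorffMeasure {d : ℕ} (μ : Measure (Pt d))
    [IsLocallyFiniteMeasure μ] (V : Submodule ℝ (Pt d)) (hV : ∀ v ∈ V, v ∈ periods μ) (x : Pt d) :
    ∃ c : NNReal, ∀ A : Set (Pt d), μ (A ∩ {z | ∃ v ∈ V, z = x + v}) =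
      c * μH[(Module.finrank ℝ V : ℝ)] (A ∩ {z | ∃ v ∈ V, z = x + v}) := by
  set ι : V → Pt d := fun v => x + v with hι
  have hiso : Isometry ι := (isometry_add_left x).comp isometry_subtype_coe
  have hemb : MeasurableEmbedding ι := hiso.isClosedEmbedding.measurableEmbedding
  have hfin : IsFiniteMeasureOnCompacts (μ.comap ι) :=
    IsFiniteMeasureOnCompacts.comap' μ hiso.continuous hemb
  have hinv : (μ.comap ι).IsAddLeftInvariant := by
    refine ⟨fun w => Measure.ext fun A hA => ?_⟩
    rw [Measure.map_apply (measurable_const_add w) hA, hemb.comap_apply, hemb.comap_apply]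
    have hw := mem_periods.1 (hV w w.2)
    conv_rhs => rw [← hw]
    rw [Measure.map_apply (by fun_prop) (hemb.measurableSet_image.2 hA)]
    congr 1
    ext z
    constructor
    · rintro ⟨v, hv, rfl⟩
      exact ⟨w + v, hv, by simp [hι]; abel⟩
    · rintro ⟨v, hv, hz⟩
      refine ⟨v - w, by simpa using hv, ?_⟩
      simp only [hι] at hz ⊢
      rw [Submodule.coe_sub, ← add_sub_assoc, hz, add_sub_cancel_right]
  refine ⟨Measure.addHaarScalarFactor (μ.comap ι) μH[Module.finrank ℝ V], fun A => ?_⟩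
  have hrange : A ∩ {z | ∃ v ∈ V, z = x + v} = ι '' (ι ⁻¹' A) := by
    ext z
    constructor
    · rintro ⟨hz, v, hv, rfl⟩
      exact ⟨⟨v, hv⟩, hz, rfl⟩
    · rintro ⟨v, hv, rfl⟩
      exact ⟨hv, v, v.2, rfl⟩
  rw [hrange, hiso.hausdorffMeasure_image (Or.inl (Nat.cast_nonneg _)), ← hemb.comap_apply]
  conv_lhs => rw [Measure.isAddLeftInvariant_eq_smul (μ.comap ι) μH[Module.finrank ℝ V]]
  rfl

lemma SmoothlyReflectionless.two_smul_sub_mem_msupp {d : ℕ} {μ : Measure (Pt d)}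
    [IsLocallyFiniteMeasure μ] (hμ : SmoothlyReflectionless μ) {x y : Pt d}
    (hx : x ∈ msupp μ) (hy : y ∈ msupp μ) : (2 : ℝ) • y - x ∈ msupp μ :=
  add_mem_msupp_of_map_eq (T := fun z => (2 : ℝ) • y - z)
    (Isometry.of_dist_eq fun _ _ => dist_sub_left _ _ _) (hμ.map_reflection hy) hx

lemma SmoothlyReflectionless.two_smul_sub_mem_periods {d : ℕ} {μ : Measure (Pt d)}
    [IsLocallyFiniteMeasure μ] (hμ : SmoothlyReflectionless μ) {x y : Pt d}
    (hx : x ∈ msupp μ) (hy : y ∈ msupp μ) : (2 : ℝ) • (x - y) ∈ periods μ := by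
  rw [mem_periods]
  conv_rhs => rw [← hμ.map_reflection hx, ← hμ.map_reflection hy]
  rw [Measure.map_map (by fun_prop) (by fun_prop)]
  congr 1
  ext1 z
  simp only [Function.comp_apply, smul_sub]
  abel

/-- Structure of smoothly reflectionless measures: a nonzero smoothly reflectionless measure
is of the form `Σ_{x ∈ E} f(x) ℋ^k|(V + x)` for a `k`-dimensional subspace `V`, a uniformly
discrete set `E ⊆ V^⊥` symmetric about each of its points, and a nonnegative symmetric
function `f` on `E`. -/
theorem reflectionless_structure (d : ℕ) (μ : Measure (Pt d))
    (hloc : IsLocallyFiniteMeasure μ) (hrefl : SmoothlyReflectionless μ) (hne : μ ≠ 0) :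
    ∃ k : ℕ, k ≤ d ∧ ∃ V : Submodule ℝ (Pt d), Module.finrank ℝ V = k ∧
      ∃ (E : Set (Pt d)) (f : Pt d → ℝ) (δ : ℝ), 0 < δ ∧
        E ⊆ (Vᗮ : Set (Pt d)) ∧
        (∀ x ∈ E, ∀ y ∈ E, x ≠ y → δ ≤ dist x y) ∧
        (∀ x ∈ E, ∀ y ∈ E, (2:ℝ) • y - x ∈ E) ∧
        (∀ x ∈ E, 0 ≤ f x) ∧
        (∀ x ∈ E, ∀ y ∈ E, f ((2:ℝ) • y - x) = f x) ∧
        ∀ A : Set (Pt d), MeasurableSet A →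
          μ A = ∑' x : E, ENNReal.ofReal (f x) *
            μH[(k : ℝ)] (A ∩ {z | ∃ v ∈ V, z = (x : Pt d) + v}) := by
  have := hloc
  obtain ⟨V, hVG, δ, hδ, hdisc⟩ := exists_submodule_le_of_isClosed (periods μ) (isClosed_periods μ)
  choose c hc using exists_measure_inter_eq_hausdorffMeasure μ V hVG
  set L : Pt d → Set (Pt d) := fun x => {z | ∃ v ∈ V, z = x + v} with hL
  have hsep : ∀ x ∈ msupp μ ∩ Vᗮ, ∀ y ∈ msupp μ ∩ Vᗮ, x ≠ y → δ / 2 ≤ dist x y := by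
    intro x hx y hy hxy
    by_contra! hlt
    have h0 := hdisc _ (hrefl.two_smul_sub_mem_periods hx.1 hy.1)
      (Submodule.smul_mem _ _ (sub_mem hx.2 hy.2))
      (by
        rw [norm_smul, Real.norm_ofNat, ← dist_eq_norm]
        linarith)
    rw [smul_eq_zero_iff_right two_ne_zero, sub_eq_zero] at h0
    exact hxy h0
  have hsymm : ∀ x ∈ msupp μ ∩ Vᗮ, ∀ y ∈ msupp μ ∩ Vᗮ,
      (2 : ℝ) • y - x ∈ msupp μ ∩ (Vᗮ : Set (Pt d)) := fun x hx y hy =>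
    ⟨hrefl.two_smul_sub_mem_msupp hx.1 hy.1, sub_mem (Submodule.smul_mem _ _ hy.2) hx.2⟩
  refine ⟨Module.finrank ℝ V, ?_, V, rfl, msupp μ ∩ Vᗮ, fun x => c x, δ / 2, half_pos hδ,
    inter_subset_right, hsep, hsymm, fun x _ => (c x).2, ?_, ?_⟩
  · simpa using Submodule.finrank_le V
  · intro x _ y hy
    have hL' : ∀ z, {w | ∃ v ∈ V, w = z + v} = L z := fun _ => rfl
    have hball : ∀ z, closedBall z 1 ∩ L z = (fun v : V => z + (v : Pt d)) '' closedBall 0 1 := by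
      intro z
      ext w
      constructor
      · rintro ⟨hw, v, hv, rfl⟩
        exact ⟨⟨v, hv⟩, by simpa using hw, rfl⟩
      · rintro ⟨v, hv, rfl⟩
        exact ⟨by simpa using hv, v, v.2, rfl⟩
    have hH : ∀ z, μ (closedBall z 1 ∩ L z) =
        c z * μH[(Module.finrank ℝ V : ℝ)] (closedBall (0 : V) 1) := by
      intro z
      have hiso : Isometry (fun v : V => z + (v : Pt d)) :=
        (isometry_add_left z).comp isometry_subtype_coe
      rw [hc z, hL', hball, hiso.hausdorffMeasure_image (Or.inl (Nat.cast_nonneg _))]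
    have hpre : (fun w => (2 : ℝ) • y - w) ⁻¹' (closedBall ((2 : ℝ) • y - x) 1 ∩
        L ((2 : ℝ) • y - x)) = closedBall x 1 ∩ L x := by
      ext w
      simp only [mem_preimage, mem_inter_iff, mem_closedBall, dist_sub_left, hL, mem_ofPred_eq]
      refine and_congr Iff.rfl ⟨?_, ?_⟩
      · rintro ⟨v, hv, hw⟩
        refine ⟨-v, neg_mem hv, ?_⟩
        rw [← sub_sub_cancel ((2 : ℝ) • y) w, hw]
        abel
      · rintro ⟨v, hv, rfl⟩
        exact ⟨-v, neg_mem hv, by abel⟩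
    have hmeas : MeasurableSet (closedBall ((2 : ℝ) • y - x) 1 ∩ L ((2 : ℝ) • y - x)) := by
      rw [hball]
      have hiso : Isometry (fun v : V => (2 : ℝ) • y - x + (v : Pt d)) :=
        (isometry_add_left _).comp isometry_subtype_coe
      exact ((isCompact_closedBall (0 : V) 1).image hiso.continuous).measurableSet
    have heq : μ (closedBall ((2 : ℝ) • y - x) 1 ∩ L ((2 : ℝ) • y - x)) =
        μ (closedBall x 1 ∩ L x) := by
      conv_lhs => rw [← hrefl.map_reflection hy.1]
      rw [Measure.map_apply (by fun_prop) hmeas, hpre]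
    rw [hH, hH] at heq
    have h0 : μH[(Module.finrank ℝ V : ℝ)] (closedBall (0 : V) 1) ≠ 0 :=
      (measure_closedBall_pos _ _ one_pos).ne'
    have htop : μH[(Module.finrank ℝ V : ℝ)] (closedBall (0 : V) 1) ≠ ⊤ :=
      (isCompact_closedBall _ _).measure_lt_top.ne
    have := (ENNReal.mul_left_inj h0 htop).1 heq
    exact congrArg NNReal.toReal (ENNReal.coe_injective this)
  · intro A hA
    have hLm : ∀ x, MeasurableSet (L x) := by
      intro x
      have : L x = (fun z => z - x) ⁻¹' (V : Set (Pt d)) := by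
        ext z
        constructor
        · rintro ⟨v, hv, rfl⟩
          simpa using hv
        · intro hz
          exact ⟨z - x, hz, by abel⟩
      rw [this]
      exact (V.closed_of_finiteDimensional.preimage (by fun_prop)).measurableSet
    have hcount : Countable ↥(msupp μ ∩ (Vᗮ : Set (Pt d))) := by
      refine (Set.PairwiseDisjoint.countable_of_isOpen (s := fun x => ball x (δ / 4)) ?_
        (fun x _ => isOpen_ball) fun x _ => ⟨x, mem_ball_self (by linarith)⟩).to_subtype
      intro x hx y hy hxy
      refine ball_disjoint_ball ?_
      linarith [hsep x hx y hy hxy]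
    have hdisj : Pairwise (Function.onFun Disjoint
        fun x : ↥(msupp μ ∩ (Vᗮ : Set (Pt d))) => A ∩ L x) := by
      intro x y hxy
      refine Set.disjoint_left.2 ?_
      rintro z ⟨-, v, hv, rfl⟩ ⟨-, w, hw, hz⟩
      apply hxy
      have h1 : (x : Pt d) - y = w - v := by
        rw [sub_eq_sub_iff_add_eq_add, hz, add_comm]
      have h2 : (x : Pt d) - y ∈ Vᗮ := sub_mem x.2.2 y.2.2
      have h3 : (x : Pt d) - y ∈ V := h1 ▸ sub_mem hw hv
      have h4 := Submodule.inner_right_of_mem_orthogonal h3 h2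
      exact Subtype.ext (sub_eq_zero.1 (inner_self_eq_zero.1 h4))
    have hcover : A ∩ msupp μ ⊆ ⋃ x : ↥(msupp μ ∩ (Vᗮ : Set (Pt d))), A ∩ L x := by
      rintro z ⟨hzA, hz⟩
      have hmem : z - V.starProjection z ∈ msupp μ := by
        have hp := mem_periods.1 (hVG _ (neg_mem (V.starProjection_apply_mem z)))
        rw [sub_eq_add_neg]
        exact add_mem_msupp_of_map_eq (T := fun w => w + -V.starProjection z)
          (isometry_add_right _) hp hz
      refine mem_iUnion.2 ⟨⟨_, hmem, V.sub_starProjection_mem_orthogonal z⟩, hzA,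
        V.starProjection z, V.starProjection_apply_mem z, by simp⟩
    have hA' : μ A = μ (⋃ x : ↥(msupp μ ∩ (Vᗮ : Set (Pt d))), A ∩ L x) := by
      refine le_antisymm ?_ (measure_mono (iUnion_subset fun _ => inter_subset_left))
      rw [← measure_inter_conull (measure_compl_msupp μ)]
      exact measure_mono hcover
    rw [hA', measure_iUnion hdisj fun x => hA.inter (hLm x)]
    refine tsum_congr fun x => ?_
    rw [ENNReal.ofReal_coe_nnreal]
    exact hc x A
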